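/- The rewrite rules of the theory (Σ_EPTS, 𝓡_EPTS), i.e. the rules El_{s₂} u_{s₁} ↪ U_{s₁} for (s₁,s₂) ∈ 𝒜 and app_{s₁,s₂} A B (abs_{s₁,s₂} A' B' M) N ↪ M N for (s₁,s₂,s₃) ∈ ℛ, together with the β-rule of Dedukti, form a confluent rewrite relation on all Dedukti terms. -/

import Mathlib

namespace DKPaper

inductive Tm (C : Type) : Type
  | var : Nat → Tm C
  | const : C → List (Tm C) → Tm C
  | type : Tm C
  | kind : Tm C
  | app : Tm C → Tm C → Tm C
  | lam : Tm C → Tm C → Tm C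
  | pi : Tm C → Tm C → Tm C

namespace Tm
variable {C : Type}

def liftRen (ρ : Nat → Nat) : Nat → Nat
  | 0 => 0
  | n + 1 => ρ n + 1

def ren (ρ : Nat → Nat) : Tm C → Tm C
  | var n => var (ρ n)
  | const c Ms => const c (Ms.attach.map fun x => ren ρ x.1)
  | type => type
  | kind => kind
  | app M N => app (ren ρ M) (ren ρ N)
  | lam A M => lam (ren ρ A) (ren (liftRen ρ) M)
  | pi A B => pi (ren ρ A) (ren (liftRen ρ) B)
termination_by t => sizeOf t
decreasing_by
  all_goals simp_wf
  all_goals try omega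
  all_goals (have h := List.sizeOf_lt_of_mem x.2; omega)

def liftSub (σ : Nat → Tm C) : Nat → Tm C
  | 0 => var 0
  | n + 1 => ren Nat.succ (σ n)

def sub (σ : Nat → Tm C) : Tm C → Tm C
  | var n => σ n
  | const c Ms => const c (Ms.attach.map fun x => sub σ x.1)
  | type => type
  | kind => kind
  | app M N => app (sub σ M) (sub σ N)
  | lam A M => lam (sub σ A) (sub (liftSub σ) M)
  | pi A B => pi (sub σ A) (sub (liftSub σ) B)
termination_by t => sizeOf t
decreasing_by
  all_goals simp_wf
  all_goals try omega
  all_goals (have h := List.sizeOf_lt_of_mem x.2; omega)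

/-- Substitution of `N` for the variable of de Bruijn index `k` (the usual `M{N/x}`). -/
def substAt (k : Nat) (N : Tm C) : Tm C → Tm C :=
  sub fun n => if n < k then var n else if n = k then ren (· + k) N else var (n - 1)

end Tm

/-! ## Signatures, rewrite rules, rewriting -/

/-- An entry `c[Δ] : A` of a signature: head constant, telescope (in declaration
order, each entry a type under the previous ones), and the type. -/
abbrev Sig (C : Type) := Set (C × List (Tm C) × Tm C)

/-- A rewrite rule `c[l⃗] ↪ r`: head constant, list of left-hand side argument
patterns (free de Bruijn variables are the pattern variables), right-hand side. -/
abbrev Rules (C : Type) := Set (C × List (Tm C) × Tm C)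

variable {C : Type}

/-- Closure of a root relation under all term-forming contexts. -/
inductive Cong (r : Tm C → Tm C → Prop) : Tm C → Tm C → Prop
  | base {M N} : r M N → Cong r M N
  | appL {M M' N} : Cong r M M' → Cong r (.app M N) (.app M' N)
  | appR {M N N'} : Cong r N N' → Cong r (.app M N) (.app M N')
  | lamA {A A' M} : Cong r A A' → Cong r (.lam A M) (.lam A' M)
  | lamM {A M M'} : Cong r M M' → Cong r (.lam A M) (.lam A M')
  | piA {A A' B} : Cong r A A' → Cong r (.pi A B) (.pi A' B)
  | piB {A B B'} : Cong r B B' → Cong r (.pi A B) (.pi A B')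
  | constArg {c l₁ M M' l₂} : Cong r M M' →
      Cong r (.const c (l₁ ++ M :: l₂)) (.const c (l₁ ++ M' :: l₂))

/-- Root β-reduction. -/
def BetaRoot : Tm C → Tm C → Prop := fun M N =>
  ∃ A P Q, M = .app (.lam A P) Q ∧ N = Tm.substAt 0 Q P

/-- Root reduction by a rule of `R`: a substitution instance of some rule. -/
def RuleRoot (R : Rules C) : Tm C → Tm C → Prop := fun M N =>
  ∃ rl ∈ R, ∃ σ : Nat → Tm C,
    M = Tm.sub σ (.const rl.1 rl.2.1) ∧ N = Tm.sub σ rl.2.2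

/-- One-step β-reduction `↪_β`. -/
def Beta : Tm C → Tm C → Prop := Cong BetaRoot

/-- One-step reduction by the rules of `R` only (no β). -/
def RStep (R : Rules C) : Tm C → Tm C → Prop := Cong (RuleRoot R)

/-- One-step reduction `↪_{β𝓡}`. -/
def Step (R : Rules C) : Tm C → Tm C → Prop :=
  Cong (fun M N => BetaRoot M N ∨ RuleRoot R M N)

/-- The conversion `≡_{β𝓡}` generated by `↪_{β𝓡}`. -/
def Conv (R : Rules C) : Tm C → Tm C → Prop := Relation.EqvGen (Step R)

/-- Confluence of an abstract reduction relation. -/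
def Confluent {α : Type _} (r : α → α → Prop) : Prop :=
  ∀ a b c, Relation.ReflTransGen r a b → Relation.ReflTransGen r a c →
    ∃ d, Relation.ReflTransGen r b d ∧ Relation.ReflTransGen r c d

/-- `M` is in β-normal form. -/
def BetaNormal (M : Tm C) : Prop := ∀ N, ¬ Beta M N

/-- Strong normalization of a relation at a point: no infinite `r`-sequence starts at `a`. -/
def SN {α : Type _} (r : α → α → Prop) (a : α) : Prop := Acc (fun x y => r y x) a


/-! ## Dedukti typing -/

/-- `IsDKSort s` means `s` is `TYPE` or `KIND`. -/
def IsDKSort (s : Tm C) : Prop := s = Tm.type ∨ s = Tm.kind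

/-- `A{M⃗}`: simultaneous instantiation of the telescope variables by the arguments. -/
def instArgs (Ms : List (Tm C)) (A : Tm C) : Tm C :=
  Tm.sub (fun n => Ms.reverse.getD n (Tm.var (n - Ms.length))) A

/-- Instantiate the first variable of the (remaining) telescope `Δ` with `M`. -/
def instTele (M : Tm C) (Δ : List (Tm C)) : List (Tm C) :=
  Δ.mapIdx fun i B => Tm.substAt i M B

mutual
/-- Well-formed contexts `Σ;Γ well-formed` (de Bruijn: last declaration first). -/
inductive Wf (S : Sig C) (R : Rules C) : List (Tm C) → Prop
  | empty : Wf S R []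
  | decl {Γ A} : Typed S R Γ A Tm.type → Wf S R (A :: Γ)

/-- The Dedukti typing judgment `Σ;Γ ⊢ M : A`. -/
inductive Typed (S : Sig C) (R : Rules C) : List (Tm C) → Tm C → Tm C → Prop
  | sort {Γ} : Wf S R Γ → Typed S R Γ Tm.type Tm.kind
  | var {Γ n A} : Wf S R Γ → Γ[n]? = some A →
      Typed S R Γ (Tm.var n) (Tm.ren (· + (n + 1)) A)
  | cons {Γ c Δ A s Ms} : (c, Δ, A) ∈ S → Typed S R Δ.reverse A s → IsDKSort s →
      TypedArgs S R Γ Ms Δ → Typed S R Γ (Tm.const c Ms) (instArgs Ms A)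
  | conv {Γ M A B s} : Typed S R Γ M A → Typed S R Γ B s → IsDKSort s →
      Conv R A B → Typed S R Γ M B
  | prod {Γ A B s} : Typed S R Γ A Tm.type → Typed S R (A :: Γ) B s → IsDKSort s →
      Typed S R Γ (Tm.pi A B) s
  | abs {Γ A B s M} : Typed S R Γ A Tm.type → Typed S R (A :: Γ) B s → IsDKSort s →
      Typed S R (A :: Γ) M B → Typed S R Γ (Tm.lam A M) (Tm.pi A B)
  | app {Γ M N A B} : Typed S R Γ M (Tm.pi A B) → Typed S R Γ N A →
      Typed S R Γ (Tm.app M N) (Tm.substAt 0 N B)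

/-- `Σ;Γ ⊢ M⃗ : Δ`: the arguments fit the telescope. -/
inductive TypedArgs (S : Sig C) (R : Rules C) : List (Tm C) → List (Tm C) → List (Tm C) → Prop
  | nil {Γ} : TypedArgs S R Γ [] []
  | cons {Γ M Ms A Δ} : Typed S R Γ M A → TypedArgs S R Γ Ms (instTele M Δ) →
      TypedArgs S R Γ (M :: Ms) (A :: Δ)
end

/-! ## Type-level and object-level constants, syntactic classes -/

/-- Types of the form `Πx⃗:B⃗.TYPE`. -/
inductive IsKindShape : Tm C → Prop
  | type : IsKindShape Tm.type
  | pi {A K} : IsKindShape K → IsKindShape (Tm.pi A K)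

/-- `c` is a type-level constant of the signature `S`. -/
def TypeLevel (S : Sig C) (c : C) : Prop := ∃ Δ A, (c, Δ, A) ∈ S ∧ IsKindShape A

/-- `c` is an object-level constant of the signature `S`: it is declared, and not type-level. -/
def ObjLevel (S : Sig C) (c : C) : Prop := (∃ Δ A, (c, Δ, A) ∈ S) ∧ ¬ TypeLevel S c

mutual
/-- Kinds: `K ::= TYPE | Πx:T.K`. -/
inductive IsKind (S : Sig C) : Tm C → Prop
  | type : IsKind S Tm.type
  | pi {T K} : IsTypeFam S T → IsKind S K → IsKind S (Tm.pi T K)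

/-- Type families: `T ::= α[O⃗] | T O | λx:T.T | Πx:T.T` with `α` type-level. -/
inductive IsTypeFam (S : Sig C) : Tm C → Prop
  | const {c Os} : TypeLevel S c → (∀ O ∈ Os, IsObj S O) → IsTypeFam S (Tm.const c Os)
  | app {T O} : IsTypeFam S T → IsObj S O → IsTypeFam S (Tm.app T O)
  | lam {T₁ T₂} : IsTypeFam S T₁ → IsTypeFam S T₂ → IsTypeFam S (Tm.lam T₁ T₂)
  | pi {T₁ T₂} : IsTypeFam S T₁ → IsTypeFam S T₂ → IsTypeFam S (Tm.pi T₁ T₂)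

/-- Objects: `O ::= x | a[O⃗] | O O | λx:T.O` with `a` object-level. -/
inductive IsObj (S : Sig C) : Tm C → Prop
  | var {n} : IsObj S (Tm.var n)
  | const {c Os} : ObjLevel S c → (∀ O ∈ Os, IsObj S O) → IsObj S (Tm.const c Os)
  | app {O₁ O₂} : IsObj S O₁ → IsObj S O₂ → IsObj S (Tm.app O₁ O₂)
  | lam {T O} : IsTypeFam S T → IsObj S O → IsObj S (Tm.lam T O)
end

mutual
/-- Pre-kinds: `L ::= TYPE | Πx:R.L`. -/
inductive PreKind (S : Sig C) : Tm C → Prop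
  | type : PreKind S Tm.type
  | pi {R L} : PreTypeFam S R → PreKind S L → PreKind S (Tm.pi R L)

/-- Pre-type families: `R ::= α[M⃗] | R N | λx:A.R | Πx:R.R` with `α` type-level
and `M⃗`, `N`, `A` arbitrary. -/
inductive PreTypeFam (S : Sig C) : Tm C → Prop
  | const {c Ms} : TypeLevel S c → PreTypeFam S (Tm.const c Ms)
  | app {R N} : PreTypeFam S R → PreTypeFam S (Tm.app R N)
  | lam {A R} : PreTypeFam S R → PreTypeFam S (Tm.lam A R)
  | pi {R₁ R₂} : PreTypeFam S R₁ → PreTypeFam S R₂ → PreTypeFam S (Tm.pi R₁ R₂)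
end

/-- A rewrite rule is type-level when its head constant is type-level. -/
def TypeLevelRule (S : Sig C) (rl : C × List (Tm C) × Tm C) : Prop := TypeLevel S rl.1

/-- The grammar `R ::= α[M⃗] | R N | λx:A.R` used to define arity preservation. -/
inductive APShape (S : Sig C) : Tm C → Prop
  | const {c Ms} : TypeLevel S c → APShape S (Tm.const c Ms)
  | app {R N} : APShape S R → APShape S (Tm.app R N)
  | lam {A R} : APShape S R → APShape S (Tm.lam A R)

/-- `𝓡` is arity preserving (w.r.t. `Σ`). -/
def ArityPreserving (S : Sig C) (R : Rules C) : Prop :=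
  ∀ rl ∈ R, TypeLevelRule S rl → APShape S rl.2.2

/-- `𝓡` is well-formed (w.r.t. `Σ`): right-hand sides of type-level rules are in
the grammar `R ::= α[M⃗] | R N | λx:B.R | Πx:R.R`. -/
def RulesWellFormed (S : Sig C) (R : Rules C) : Prop :=
  ∀ rl ∈ R, TypeLevelRule S rl → PreTypeFam S rl.2.2

/-! ## Simple types and the erasure maps -/

/-- Simple types `σ ::= * | σ → σ`. -/
inductive STy : Type
  | star : STy
  | arr : STy → STy → STy
deriving DecidableEq

open Classical in
/-- The partial type erasure `⌈·⌉` from Dedukti terms to simple types. -/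
noncomputable def tyErase (S : Sig C) : Tm C → Option STy
  | Tm.type => some STy.star
  | Tm.const c _ => if TypeLevel S c then some STy.star else none
  | Tm.pi A B => do return STy.arr (← tyErase S A) (← tyErase S B)
  | Tm.app A _ => tyErase S A
  | Tm.lam _ B => tyErase S B
  | Tm.var _ => none
  | Tm.kind => none

/-- Untyped λ-terms with constants in `K` (the target of the term erasure). -/
inductive LTm (K : Type) : Type
  | var : Nat → LTm K
  | const : K → LTm K
  | app : LTm K → LTm K → LTm K
  | lam : LTm K → LTm K

namespace LTm
variable {K : Type}

def liftRen' (ρ : Nat → Nat) : Nat → Nat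
  | 0 => 0
  | n + 1 => ρ n + 1

def ren (ρ : Nat → Nat) : LTm K → LTm K
  | var n => var (ρ n)
  | const k => const k
  | app M N => app (ren ρ M) (ren ρ N)
  | lam M => lam (ren (liftRen' ρ) M)

/-- Shift free variables `≥ d` up by one. -/
def shiftAbove (d : Nat) : LTm K → LTm K :=
  ren fun n => if n < d then n else n + 1

def liftSub (σ : Nat → LTm K) : Nat → LTm K
  | 0 => var 0
  | n + 1 => ren Nat.succ (σ n)

def sub (σ : Nat → LTm K) : LTm K → LTm K
  | var n => σ n
  | const k => const k
  | app M N => app (sub σ M) (sub σ N)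
  | lam M => lam (sub (liftSub σ) M)

/-- Substitution `M{N/x}` for the variable of index `k`. -/
def substAt (k : Nat) (N : LTm K) : LTm K → LTm K :=
  sub fun n => if n < k then var n else if n = k then ren (· + k) N else var (n - 1)

end LTm

/-- β-reduction for the (simply-typed) λ-calculus. -/
inductive LBeta {K : Type} : LTm K → LTm K → Prop
  | red {M N} : LBeta (LTm.app (LTm.lam M) N) (LTm.substAt 0 N M)
  | appL {M M' N} : LBeta M M' → LBeta (LTm.app M N) (LTm.app M' N)
  | appR {M N N'} : LBeta N N' → LBeta (LTm.app M N) (LTm.app M N')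
  | lam {M M'} : LBeta M M' → LBeta (LTm.lam M) (LTm.lam M')

/-- The partial term erasure `|·|` from Dedukti terms into the λ-calculus with
constants `C ⊕ STy` (`Sum.inr σ` being the constant `π_σ`). -/
noncomputable def erase (S : Sig C) : Tm C → Option (LTm (C ⊕ STy))
  | Tm.var n => some (LTm.var n)
  | Tm.const c Ms => do
      let ts ← Ms.attach.mapM fun x => erase S x.1
      return ts.foldl LTm.app (LTm.const (Sum.inl c))
  | Tm.app M N => do return LTm.app (← erase S M) (← erase S N)
  | Tm.lam A M => do
      return LTm.app (LTm.lam (LTm.lam (LTm.shiftAbove 1 (← erase S M)))) (← erase S A)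
  | Tm.pi A B => do
      return LTm.app (LTm.app (LTm.const (Sum.inr (← tyErase S A))) (← erase S A))
        (LTm.lam (← erase S B))
  | Tm.type => none
  | Tm.kind => none
termination_by t => sizeOf t
decreasing_by
  all_goals simp_wf
  all_goals try omega
  all_goals (have h := List.sizeOf_lt_of_mem x.2; omega)

/-- The type `* → (σ → *) → *` of the constant `π_σ`. -/
def piConstTy (σ : STy) : STy := STy.arr STy.star (STy.arr (STy.arr σ STy.star) STy.star)

/-- `⌈A₁⌉ → ... → ⌈Aₙ⌉ → ⌈A⌉`, as a relation (defined when all erasures are). -/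
inductive EraseTele (S : Sig C) : List (Tm C) → Tm C → STy → Prop
  | nil {A σ} : tyErase S A = some σ → EraseTele S [] A σ
  | cons {B Δ A τ σ} : tyErase S B = some τ → EraseTele S Δ A σ →
      EraseTele S (B :: Δ) A (STy.arr τ σ)

/-- The simply-typed constant context `Γ_π, ⌈Σ'⌉`: it declares `π_σ : * → (σ → *) → *`
for every simple type `σ`, and `c : ⌈A₁⌉ → ... → ⌈Aₙ⌉ → ⌈A⌉` for every
declaration `c[x₁:A₁,...,xₙ:Aₙ] : A` of `Σ'` (erasures being taken w.r.t. `S`). -/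
inductive ConstTy (S : Sig C) (S' : Sig C) : C ⊕ STy → STy → Prop
  | piConst (σ : STy) : ConstTy S S' (Sum.inr σ) (piConstTy σ)
  | const {c Δ A σ} : (c, Δ, A) ∈ S' → EraseTele S Δ A σ → ConstTy S S' (Sum.inl c) σ

/-- Typing in the simply-typed λ-calculus, with constants typed by `cty`. -/
inductive STTyped {K : Type} (cty : K → STy → Prop) : List STy → LTm K → STy → Prop
  | var {Γ n σ} : Γ[n]? = some σ → STTyped cty Γ (LTm.var n) σ
  | const {Γ k σ} : cty k σ → STTyped cty Γ (LTm.const k) σ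
  | app {Γ M N σ τ} : STTyped cty Γ M (STy.arr σ τ) → STTyped cty Γ N σ →
      STTyped cty Γ (LTm.app M N) τ
  | lam {Γ M σ τ} : STTyped cty (σ :: Γ) M τ → STTyped cty Γ (LTm.lam M) (STy.arr σ τ)

/-! ## Explicitly-typed Pure Type Systems (EPTS) -/

/-- EPTS terms (de Bruijn): `x | s | Π_{s₁,s₂}(A,[x]B) | λ_{s₁,s₂}(A,[x]B,[x]M) |
@_{s₁,s₂}(A,[x]B,M,N)`. -/
inductive ETm (S : Type) : Type
  | var : Nat → ETm S
  | sort : S → ETm S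
  | pi : S → S → ETm S → ETm S → ETm S
  | lam : S → S → ETm S → ETm S → ETm S → ETm S
  | app : S → S → ETm S → ETm S → ETm S → ETm S → ETm S

namespace ETm
variable {S : Type}

def ren (ρ : Nat → Nat) : ETm S → ETm S
  | var n => var (ρ n)
  | sort s => sort s
  | pi s₁ s₂ A B => pi s₁ s₂ (ren ρ A) (ren (Tm.liftRen ρ) B)
  | lam s₁ s₂ A B M => lam s₁ s₂ (ren ρ A) (ren (Tm.liftRen ρ) B) (ren (Tm.liftRen ρ) M)
  | app s₁ s₂ A B M N => app s₁ s₂ (ren ρ A) (ren (Tm.liftRen ρ) B) (ren ρ M) (ren ρ N)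

def liftSub (σ : Nat → ETm S) : Nat → ETm S
  | 0 => var 0
  | n + 1 => ren Nat.succ (σ n)

def sub (σ : Nat → ETm S) : ETm S → ETm S
  | var n => σ n
  | sort s => sort s
  | pi s₁ s₂ A B => pi s₁ s₂ (sub σ A) (sub (liftSub σ) B)
  | lam s₁ s₂ A B M => lam s₁ s₂ (sub σ A) (sub (liftSub σ) B) (sub (liftSub σ) M)
  | app s₁ s₂ A B M N => app s₁ s₂ (sub σ A) (sub (liftSub σ) B) (sub σ M) (sub σ N)

/-- Substitution `M{N/x}` for the variable of de Bruijn index `k`. -/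
def substAt (k : Nat) (N : ETm S) : ETm S → ETm S :=
  sub fun n => if n < k then var n else if n = k then ren (· + k) N else var (n - 1)

end ETm

variable {S : Type}

/-- Closure of a root relation under all EPTS term-forming contexts. -/
inductive ECong (r : ETm S → ETm S → Prop) : ETm S → ETm S → Prop
  | base {M N} : r M N → ECong r M N
  | piA {s₁ s₂ A A' B} : ECong r A A' → ECong r (.pi s₁ s₂ A B) (.pi s₁ s₂ A' B)
  | piB {s₁ s₂ A B B'} : ECong r B B' → ECong r (.pi s₁ s₂ A B) (.pi s₁ s₂ A B')
  | lamA {s₁ s₂ A A' B M} : ECong r A A' → ECong r (.lam s₁ s₂ A B M) (.lam s₁ s₂ A' B M)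
  | lamB {s₁ s₂ A B B' M} : ECong r B B' → ECong r (.lam s₁ s₂ A B M) (.lam s₁ s₂ A B' M)
  | lamM {s₁ s₂ A B M M'} : ECong r M M' → ECong r (.lam s₁ s₂ A B M) (.lam s₁ s₂ A B M')
  | appA {s₁ s₂ A A' B M N} : ECong r A A' → ECong r (.app s₁ s₂ A B M N) (.app s₁ s₂ A' B M N)
  | appB {s₁ s₂ A B B' M N} : ECong r B B' → ECong r (.app s₁ s₂ A B M N) (.app s₁ s₂ A B' M N)
  | appM {s₁ s₂ A B M M' N} : ECong r M M' → ECong r (.app s₁ s₂ A B M N) (.app s₁ s₂ A B M' N)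
  | appN {s₁ s₂ A B M N N'} : ECong r N N' → ECong r (.app s₁ s₂ A B M N) (.app s₁ s₂ A B M N')

/-- Root β-reduction of the EPTS (linearized rule, one instance per `(s₁,s₂,s₃) ∈ ℛ`):
`@_{s₁,s₂}(A,[x]B, λ_{s₁,s₂}(A',[x]B',[x]M), N) ↪ M{N/x}`. -/
def EBetaRoot (Rrel : S → S → S → Prop) : ETm S → ETm S → Prop := fun M N =>
  ∃ s₁ s₂ s₃ A B A' B' P Q, Rrel s₁ s₂ s₃ ∧
    M = ETm.app s₁ s₂ A B (ETm.lam s₁ s₂ A' B' P) Q ∧ N = ETm.substAt 0 Q P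

/-- One-step EPTS reduction. -/
def EStep (Rrel : S → S → S → Prop) : ETm S → ETm S → Prop := ECong (EBetaRoot Rrel)

/-- EPTS conversion `≡`. -/
def EConv (Rrel : S → S → S → Prop) : ETm S → ETm S → Prop := Relation.EqvGen (EStep Rrel)

mutual
/-- Well-formed EPTS contexts. -/
inductive EWf (Ar : S → S → Prop) (Rr : S → S → S → Prop) : List (ETm S) → Prop
  | empty : EWf Ar Rr []
  | decl {Γ A s} : ETyped Ar Rr Γ A (ETm.sort s) → EWf Ar Rr (A :: Γ)

/-- The EPTS typing judgment `Γ ⊢ M : A`. -/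
inductive ETyped (Ar : S → S → Prop) (Rr : S → S → S → Prop) : List (ETm S) → ETm S → ETm S → Prop
  | sort {Γ s₁ s₂} : EWf Ar Rr Γ → Ar s₁ s₂ → ETyped Ar Rr Γ (ETm.sort s₁) (ETm.sort s₂)
  | var {Γ n A} : EWf Ar Rr Γ → Γ[n]? = some A →
      ETyped Ar Rr Γ (ETm.var n) (ETm.ren (· + (n + 1)) A)
  | conv {Γ M A B s} : ETyped Ar Rr Γ M A → ETyped Ar Rr Γ B (ETm.sort s) →
      EConv Rr A B → ETyped Ar Rr Γ M B
  | pi {Γ s₁ s₂ s₃ A B} : Rr s₁ s₂ s₃ → ETyped Ar Rr Γ A (ETm.sort s₁) →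
      ETyped Ar Rr (A :: Γ) B (ETm.sort s₂) →
      ETyped Ar Rr Γ (ETm.pi s₁ s₂ A B) (ETm.sort s₃)
  | lam {Γ s₁ s₂ s₃ A B M} : Rr s₁ s₂ s₃ → ETyped Ar Rr Γ A (ETm.sort s₁) →
      ETyped Ar Rr (A :: Γ) B (ETm.sort s₂) → ETyped Ar Rr (A :: Γ) M B →
      ETyped Ar Rr Γ (ETm.lam s₁ s₂ A B M) (ETm.pi s₁ s₂ A B)
  | app {Γ s₁ s₂ s₃ A B M N} : Rr s₁ s₂ s₃ → ETyped Ar Rr Γ A (ETm.sort s₁) →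
      ETyped Ar Rr (A :: Γ) B (ETm.sort s₂) → ETyped Ar Rr Γ N A →
      ETyped Ar Rr Γ M (ETm.pi s₁ s₂ A B) →
      ETyped Ar Rr Γ (ETm.app s₁ s₂ A B M N) (ETm.substAt 0 N B)
end

/-- `𝒜` and `ℛ` are functional relations. -/
def FunctionalSpec (Ar : S → S → Prop) (Rr : S → S → S → Prop) : Prop :=
  (∀ s t t', Ar s t → Ar s t' → t = t') ∧
  (∀ s₁ s₂ t t', Rr s₁ s₂ t → Rr s₁ s₂ t' → t = t')

/-- `s` is a top-sort. -/
def IsTopSort (Ar : S → S → Prop) (s : S) : Prop := ¬ ∃ s', Ar s s'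

/-- `Γ ⊢ A type`: `A` is a sort, or `Γ ⊢ A : s` for some sort `s`. -/
def ETypeJ (Ar : S → S → Prop) (Rr : S → S → S → Prop) (Γ : List (ETm S)) (A : ETm S) : Prop :=
  (∃ s, A = ETm.sort s) ∨ ∃ s, ETyped Ar Rr Γ A (ETm.sort s)

/-! ## (Implicit) Pure Type Systems -/

/-- PTS terms. -/
inductive PTm (S : Type) : Type
  | var : Nat → PTm S
  | sort : S → PTm S
  | pi : PTm S → PTm S → PTm S
  | lam : PTm S → PTm S → PTm S
  | app : PTm S → PTm S → PTm S

namespace PTm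
variable {S : Type}

def ren (ρ : Nat → Nat) : PTm S → PTm S
  | var n => var (ρ n)
  | sort s => sort s
  | pi A B => pi (ren ρ A) (ren (Tm.liftRen ρ) B)
  | lam A M => lam (ren ρ A) (ren (Tm.liftRen ρ) M)
  | app M N => app (ren ρ M) (ren ρ N)

def liftSub (σ : Nat → PTm S) : Nat → PTm S
  | 0 => var 0
  | n + 1 => ren Nat.succ (σ n)

def sub (σ : Nat → PTm S) : PTm S → PTm S
  | var n => σ n
  | sort s => sort s
  | pi A B => pi (sub σ A) (sub (liftSub σ) B)
  | lam A M => lam (sub σ A) (sub (liftSub σ) M)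
  | app M N => app (sub σ M) (sub σ N)

def substAt (k : Nat) (N : PTm S) : PTm S → PTm S :=
  sub fun n => if n < k then var n else if n = k then ren (· + k) N else var (n - 1)

end PTm

/-- One-step β-reduction of PTS terms. -/
inductive PBeta : PTm S → PTm S → Prop
  | red {A M N} : PBeta (PTm.app (PTm.lam A M) N) (PTm.substAt 0 N M)
  | piA {A A' B} : PBeta A A' → PBeta (PTm.pi A B) (PTm.pi A' B)
  | piB {A B B'} : PBeta B B' → PBeta (PTm.pi A B) (PTm.pi A B')
  | lamA {A A' M} : PBeta A A' → PBeta (PTm.lam A M) (PTm.lam A' M)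
  | lamM {A M M'} : PBeta M M' → PBeta (PTm.lam A M) (PTm.lam A M')
  | appL {M M' N} : PBeta M M' → PBeta (PTm.app M N) (PTm.app M' N)
  | appR {M N N'} : PBeta N N' → PBeta (PTm.app M N) (PTm.app M N')

/-- PTS conversion. -/
def PConv : PTm S → PTm S → Prop := Relation.EqvGen PBeta

mutual
/-- Well-formed PTS contexts. -/
inductive PWf (Ar : S → S → Prop) (Rr : S → S → S → Prop) : List (PTm S) → Prop
  | empty : PWf Ar Rr []
  | decl {Γ A s} : PTyped Ar Rr Γ A (PTm.sort s) → PWf Ar Rr (A :: Γ)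

/-- The PTS typing judgment. -/
inductive PTyped (Ar : S → S → Prop) (Rr : S → S → S → Prop) : List (PTm S) → PTm S → PTm S → Prop
  | sort {Γ s₁ s₂} : PWf Ar Rr Γ → Ar s₁ s₂ → PTyped Ar Rr Γ (PTm.sort s₁) (PTm.sort s₂)
  | var {Γ n A} : PWf Ar Rr Γ → Γ[n]? = some A →
      PTyped Ar Rr Γ (PTm.var n) (PTm.ren (· + (n + 1)) A)
  | conv {Γ M A B s} : PTyped Ar Rr Γ M A → PTyped Ar Rr Γ B (PTm.sort s) →
      PConv A B → PTyped Ar Rr Γ M B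
  | pi {Γ s₁ s₂ s₃ A B} : Rr s₁ s₂ s₃ → PTyped Ar Rr Γ A (PTm.sort s₁) →
      PTyped Ar Rr (A :: Γ) B (PTm.sort s₂) →
      PTyped Ar Rr Γ (PTm.pi A B) (PTm.sort s₃)
  | lam {Γ s₁ s₂ s₃ A B M} : Rr s₁ s₂ s₃ → PTyped Ar Rr Γ A (PTm.sort s₁) →
      PTyped Ar Rr (A :: Γ) B (PTm.sort s₂) → PTyped Ar Rr (A :: Γ) M B →
      PTyped Ar Rr Γ (PTm.lam A M) (PTm.pi A B)
  | app {Γ A B M N} : PTyped Ar Rr Γ M (PTm.pi A B) → PTyped Ar Rr Γ N A →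
      PTyped Ar Rr Γ (PTm.app M N) (PTm.substAt 0 N B)
end

/-- `Γ ⊢_PTS A type`. -/
def PTypeJ (Ar : S → S → Prop) (Rr : S → S → S → Prop) (Γ : List (PTm S)) (A : PTm S) : Prop :=
  (∃ s, A = PTm.sort s) ∨ ∃ s, PTyped Ar Rr Γ A (PTm.sort s)

/-- The natural erasure from EPTS terms to PTS terms. -/
def epsErase : ETm S → PTm S
  | ETm.var n => PTm.var n
  | ETm.sort s => PTm.sort s
  | ETm.pi _ _ A B => PTm.pi (epsErase A) (epsErase B)
  | ETm.lam _ _ A _ M => PTm.lam (epsErase A) (epsErase M)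
  | ETm.app _ _ _ _ M N => PTm.app (epsErase M) (epsErase N)

/-! ## The encoding of EPTSs in Dedukti -/

/-- The constants of the theory `(Σ_EPTS, 𝓡_EPTS)`. -/
inductive EConst (S : Type) : Type
  | U : S → EConst S
  | El : S → EConst S
  | u : S → EConst S
  | Prod : S → S → EConst S
  | abs : S → S → EConst S
  | app : S → S → EConst S

/-- `U_s`. -/
def Ucon (s : S) : Tm (EConst S) := Tm.const (EConst.U s) []
/-- `El_s A`. -/
def Elcon (s : S) (A : Tm (EConst S)) : Tm (EConst S) := Tm.const (EConst.El s) [A]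
/-- `u_s`. -/
def ucon (s : S) : Tm (EConst S) := Tm.const (EConst.u s) []
/-- `Prod_{s₁,s₂} A B`. -/
def ProdC (s₁ s₂ : S) (A B : Tm (EConst S)) : Tm (EConst S) :=
  Tm.const (EConst.Prod s₁ s₂) [A, B]
/-- `abs_{s₁,s₂} A B M`. -/
def absC (s₁ s₂ : S) (A B M : Tm (EConst S)) : Tm (EConst S) :=
  Tm.const (EConst.abs s₁ s₂) [A, B, M]
/-- `app_{s₁,s₂} A B M N`. -/
def appC (s₁ s₂ : S) (A B M N : Tm (EConst S)) : Tm (EConst S) :=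
  Tm.const (EConst.app s₁ s₂) [A, B, M, N]

/-- The signature `Σ_EPTS` (telescopes in de Bruijn form). -/
inductive SigEPTSMem (Ar : S → S → Prop) (Rr : S → S → S → Prop) :
    EConst S × List (Tm (EConst S)) × Tm (EConst S) → Prop
  | U (s : S) : SigEPTSMem Ar Rr (EConst.U s, [], Tm.type)
  | El (s : S) : SigEPTSMem Ar Rr (EConst.El s, [Ucon s], Tm.type)
  | u {s₁ s₂} : Ar s₁ s₂ → SigEPTSMem Ar Rr (EConst.u s₁, [], Ucon s₂)
  | Prod {s₁ s₂ s₃} : Rr s₁ s₂ s₃ →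
      SigEPTSMem Ar Rr (EConst.Prod s₁ s₂,
        [Ucon s₁, Tm.pi (Elcon s₁ (Tm.var 0)) (Ucon s₂)],
        Ucon s₃)
  | abs {s₁ s₂ s₃} : Rr s₁ s₂ s₃ →
      SigEPTSMem Ar Rr (EConst.abs s₁ s₂,
        [Ucon s₁, Tm.pi (Elcon s₁ (Tm.var 0)) (Ucon s₂),
         Tm.pi (Elcon s₁ (Tm.var 1)) (Elcon s₂ (Tm.app (Tm.var 1) (Tm.var 0)))],
        Elcon s₃ (ProdC s₁ s₂ (Tm.var 2) (Tm.var 1)))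
  | app {s₁ s₂ s₃} : Rr s₁ s₂ s₃ →
      SigEPTSMem Ar Rr (EConst.app s₁ s₂,
        [Ucon s₁, Tm.pi (Elcon s₁ (Tm.var 0)) (Ucon s₂),
         Elcon s₃ (ProdC s₁ s₂ (Tm.var 1) (Tm.var 0)),
         Elcon s₁ (Tm.var 2)],
        Elcon s₂ (Tm.app (Tm.var 2) (Tm.var 0)))

/-- `Σ_EPTS` as a signature. -/
def sigEPTS (Ar : S → S → Prop) (Rr : S → S → S → Prop) : Sig (EConst S) :=
  fun e => SigEPTSMem Ar Rr e

/-- The rules `El_{s₂} u_{s₁} ↪ U_{s₁}` for `(s₁,s₂) ∈ 𝒜`. -/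
inductive URulesMem (Ar : S → S → Prop) :
    EConst S × List (Tm (EConst S)) × Tm (EConst S) → Prop
  | u_red {s₁ s₂} : Ar s₁ s₂ → URulesMem Ar (EConst.El s₂, [ucon s₁], Ucon s₁)

/-- The rules `app_{s₁,s₂} A B (abs_{s₁,s₂} A' B' M) N ↪ M N` for `(s₁,s₂,s₃) ∈ ℛ`
(pattern variables `A,B,A',B',M,N` are the de Bruijn variables `0,…,5`). -/
inductive BetaRulesMem (Rr : S → S → S → Prop) :
    EConst S × List (Tm (EConst S)) × Tm (EConst S) → Prop
  | beta {s₁ s₂ s₃} : Rr s₁ s₂ s₃ →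
      BetaRulesMem Rr (EConst.app s₁ s₂,
        [Tm.var 0, Tm.var 1, absC s₁ s₂ (Tm.var 2) (Tm.var 3) (Tm.var 4), Tm.var 5],
        Tm.app (Tm.var 4) (Tm.var 5))

/-- The `u_{s₁}`-red rules as a rule set. -/
def uRules (Ar : S → S → Prop) : Rules (EConst S) := fun e => URulesMem Ar e

/-- The `beta_{s₁,s₂}` rules as a rule set. -/
def betaRules (Rr : S → S → S → Prop) : Rules (EConst S) := fun e => BetaRulesMem Rr e

/-- The rewrite system `𝓡_EPTS`. -/
def rulesEPTS (Ar : S → S → Prop) (Rr : S → S → S → Prop) : Rules (EConst S) :=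
  uRules Ar ∪ betaRules Rr

/-- The translation `⟦·⟧` from EPTS terms to Dedukti terms. -/
def trans : ETm S → Tm (EConst S)
  | ETm.var n => Tm.var n
  | ETm.sort s => ucon s
  | ETm.pi s₁ s₂ A B =>
      ProdC s₁ s₂ (trans A) (Tm.lam (Elcon s₁ (trans A)) (trans B))
  | ETm.lam s₁ s₂ A B M =>
      absC s₁ s₂ (trans A) (Tm.lam (Elcon s₁ (trans A)) (trans B))
        (Tm.lam (Elcon s₁ (trans A)) (trans M))
  | ETm.app s₁ s₂ A B M N =>
      appC s₁ s₂ (trans A) (Tm.lam (Elcon s₁ (trans A)) (trans B)) (trans M) (trans N)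

/-- The translation `⟦·⟧` on (well-formed) contexts: `⟦Γ, x:A⟧ = ⟦Γ⟧, x : El_{s_A} ⟦A⟧`
where `Γ ⊢ A : s_A`. -/
inductive TransCtx (Ar : S → S → Prop) (Rr : S → S → S → Prop) :
    List (ETm S) → List (Tm (EConst S)) → Prop
  | nil : TransCtx Ar Rr [] []
  | cons {Γ Δ A sA} : TransCtx Ar Rr Γ Δ → ETyped Ar Rr Γ A (ETm.sort sA) →
      TransCtx Ar Rr (A :: Γ) (Elcon sA (trans A) :: Δ)

/-- Invertible forms. -/
inductive Invertible : Tm (EConst S) → Prop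
  | var {n} : Invertible (Tm.var n)
  | u {s} : Invertible (ucon s)
  | abs {s₁ s₂ A T₁ B T₂ M} : Invertible A → Invertible B → Invertible M →
      Invertible (absC s₁ s₂ A (Tm.lam T₁ B) (Tm.lam T₂ M))
  | beta {T M N} : Invertible M → Invertible N →
      Invertible (Tm.app (Tm.lam T M) N)
  | prod {s₁ s₂ A T₁ B} : Invertible A → Invertible B →
      Invertible (ProdC s₁ s₂ A (Tm.lam T₁ B))
  | app {s₁ s₂ A T₁ B M N} : Invertible A → Invertible B → Invertible M → Invertible N →
      Invertible (appC s₁ s₂ A (Tm.lam T₁ B) M N)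

/-- The inverse translation `|·|`, defined (at least) on invertible forms. -/
def inv : Tm (EConst S) → Option (ETm S)
  | Tm.var n => some (ETm.var n)
  | Tm.const (EConst.u s) [] => some (ETm.sort s)
  | Tm.app (Tm.lam _ M) N => do
      return ETm.substAt 0 (← inv N) (← inv M)
  | Tm.const (EConst.Prod s₁ s₂) [A, Tm.lam _ B] => do
      return ETm.pi s₁ s₂ (← inv A) (← inv B)
  | Tm.const (EConst.abs s₁ s₂) [A, Tm.lam _ B, Tm.lam _ M] => do
      return ETm.lam s₁ s₂ (← inv A) (← inv B) (← inv M)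
  | Tm.const (EConst.app s₁ s₂) [A, Tm.lam _ B, M, N] => do
      return ETm.app s₁ s₂ (← inv A) (← inv B) (← inv M) (← inv N)
  | _ => none
termination_by t => sizeOf t
decreasing_by
  all_goals simp_wf
  all_goals omega

/-- Hidden rewriting steps: a `↪_{β𝓡}` step inside the type annotation of a binder. -/
def HStep (R : Rules (EConst S)) : Tm (EConst S) → Tm (EConst S) → Prop :=
  Cong fun M N => ∃ A A' P, Step R A A' ∧ M = Tm.lam A P ∧ N = Tm.lam A' P

/-- The hidden conversion `≡_H`. -/
def HConv (R : Rules (EConst S)) : Tm (EConst S) → Tm (EConst S) → Prop :=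
  Relation.EqvGen (HStep R)


/-! ## Substitution lemmas -/

namespace Tm

@[elab_as_elim]
theorem induct {motive : Tm C → Prop} (var : ∀ n, motive (var n))
    (const : ∀ c Ms, (∀ M ∈ Ms, motive M) → motive (const c Ms))
    (type : motive type) (kind : motive kind)
    (app : ∀ M N, motive M → motive N → motive (app M N))
    (lam : ∀ A M, motive A → motive M → motive (lam A M))
    (pi : ∀ A B, motive A → motive B → motive (pi A B)) (M : Tm C) : motive M :=
  Tm.rec (motive_1 := motive) (motive_2 := fun Ms => ∀ M ∈ Ms, motive M)
    var const type kind app lam pi (by simp)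
    (fun _ _ hM hMs => List.forall_mem_cons.2 ⟨hM, hMs⟩) M

@[simp] theorem ren_var (ρ : Nat → Nat) (n : Nat) : ren ρ (var n : Tm C) = var (ρ n) := by
  rw [ren]

@[simp] theorem ren_const (ρ : Nat → Nat) (c : C) (Ms : List (Tm C)) :
    ren ρ (const c Ms) = const c (Ms.map (ren ρ)) := by
  rw [ren, List.attach_map_val]

@[simp] theorem ren_type (ρ : Nat → Nat) : ren ρ (type : Tm C) = type := by rw [ren]

@[simp] theorem ren_kind (ρ : Nat → Nat) : ren ρ (kind : Tm C) = kind := by rw [ren]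

@[simp] theorem ren_app (ρ : Nat → Nat) (M N : Tm C) :
    ren ρ (app M N) = app (ren ρ M) (ren ρ N) := by
  rw [ren]

@[simp] theorem ren_lam (ρ : Nat → Nat) (A M : Tm C) :
    ren ρ (lam A M) = lam (ren ρ A) (ren (liftRen ρ) M) := by
  rw [ren]

@[simp] theorem ren_pi (ρ : Nat → Nat) (A B : Tm C) :
    ren ρ (pi A B) = pi (ren ρ A) (ren (liftRen ρ) B) := by
  rw [ren]

@[simp] theorem sub_var (σ : Nat → Tm C) (n : Nat) : sub σ (var n) = σ n := by rw [sub]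

@[simp] theorem sub_const (σ : Nat → Tm C) (c : C) (Ms : List (Tm C)) :
    sub σ (const c Ms) = const c (Ms.map (sub σ)) := by
  rw [sub, List.attach_map_val]

@[simp] theorem sub_type (σ : Nat → Tm C) : sub σ type = type := by rw [sub]

@[simp] theorem sub_kind (σ : Nat → Tm C) : sub σ kind = kind := by rw [sub]

@[simp] theorem sub_app (σ : Nat → Tm C) (M N : Tm C) :
    sub σ (app M N) = app (sub σ M) (sub σ N) := by
  rw [sub]

@[simp] theorem sub_lam (σ : Nat → Tm C) (A M : Tm C) :
    sub σ (lam A M) = lam (sub σ A) (sub (liftSub σ) M) := by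
  rw [sub]

@[simp] theorem sub_pi (σ : Nat → Tm C) (A B : Tm C) :
    sub σ (pi A B) = pi (sub σ A) (sub (liftSub σ) B) := by
  rw [sub]

theorem liftSub_var_comp (ρ : Nat → Nat) :
    liftSub (fun n => (var (ρ n) : Tm C)) = fun n => var (liftRen ρ n) := by
  funext n
  cases n <;> simp [liftSub, liftRen]

theorem ren_eq_sub (M : Tm C) (ρ : Nat → Nat) : ren ρ M = sub (fun n => var (ρ n)) M := by
  induction M using induct generalizing ρ with
  | const c Ms ih => simpa using fun M hM => ih M hM ρ
  | _ => simp_all [liftSub_var_comp]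

theorem liftSub_var : liftSub (var : Nat → Tm C) = var := by
  funext n
  cases n <;> simp [liftSub]

theorem sub_var_id (M : Tm C) : sub var M = M := by
  induction M using induct with
  | const c Ms ih =>
    simp only [sub_const, const.injEq, true_and]
    exact (List.map_congr_left ih).trans (List.map_id' Ms)
  | _ => simp_all [liftSub_var]

theorem liftSub_comp_liftRen (σ : Nat → Tm C) (ρ : Nat → Nat) :
    (fun n => liftSub σ (liftRen ρ n)) = liftSub fun n => σ (ρ n) := by
  funext n
  cases n <;> rfl

theorem sub_ren (M : Tm C) (σ : Nat → Tm C) (ρ : Nat → Nat) :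
    sub σ (ren ρ M) = sub (fun n => σ (ρ n)) M := by
  induction M using induct generalizing σ ρ with
  | const c Ms ih => simpa using fun M hM => ih M hM σ ρ
  | _ => simp_all [liftSub_comp_liftRen]

theorem ren_ren (M : Tm C) (τ ρ : Nat → Nat) : ren τ (ren ρ M) = ren (fun n => τ (ρ n)) M := by
  rw [ren_eq_sub (ren ρ M), sub_ren, ← ren_eq_sub M]

theorem ren_liftRen_comp_liftSub (σ : Nat → Tm C) (ρ : Nat → Nat) :
    (fun n => ren (liftRen ρ) (liftSub σ n)) = liftSub fun n => ren ρ (σ n) := by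
  funext n
  cases n <;> simp [liftSub, liftRen, ren_ren]

theorem ren_sub (M : Tm C) (σ : Nat → Tm C) (ρ : Nat → Nat) :
    ren ρ (sub σ M) = sub (fun n => ren ρ (σ n)) M := by
  induction M using induct generalizing σ ρ with
  | const c Ms ih => simpa using fun M hM => ih M hM σ ρ
  | _ => simp_all [ren_liftRen_comp_liftSub]

theorem sub_liftSub_comp_liftSub (τ σ : Nat → Tm C) :
    (fun n => sub (liftSub τ) (liftSub σ n)) = liftSub fun n => sub τ (σ n) := by
  funext n
  cases n <;> simp [liftSub, sub_ren, ren_sub]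

theorem sub_sub (M : Tm C) (τ σ : Nat → Tm C) :
    sub τ (sub σ M) = sub (fun n => sub τ (σ n)) M := by
  induction M using induct generalizing τ σ with
  | const c Ms ih => simpa using fun M hM => ih M hM τ σ
  | _ => simp_all [sub_liftSub_comp_liftSub]

/-- The substitution of `N` for the variable `0`, lowering all others. -/
def single (N : Tm C) : Nat → Tm C
  | 0 => N
  | n + 1 => var n

theorem substAt_zero (N M : Tm C) : substAt 0 N M = sub (single N) M := by
  unfold substAt
  congr 1
  funext n
  cases n <;> simp [single, ren_eq_sub, sub_var_id]

theorem sub_substAt_zero (σ : Nat → Tm C) (N M : Tm C) :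
    sub σ (substAt 0 N M) = substAt 0 (sub σ N) (sub (liftSub σ) M) := by
  rw [substAt_zero, substAt_zero, sub_sub, sub_sub]
  congr 1
  funext n
  cases n <;> simp [single, liftSub, sub_ren, sub_var_id]

theorem ren_substAt_zero (ρ : Nat → Nat) (N M : Tm C) :
    ren ρ (substAt 0 N M) = substAt 0 (ren ρ N) (ren (liftRen ρ) M) := by
  simp only [ren_eq_sub, sub_substAt_zero, liftSub_var_comp]

end Tm

/-! ## Parallel reduction -/

/-- Parallel reduction for `β` and the rules of `𝓡_EPTS`. -/
inductive Par (Ar : S → S → Prop) (Rr : S → S → S → Prop) :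
    Tm (EConst S) → Tm (EConst S) → Prop
  | var (n) : Par Ar Rr (.var n) (.var n)
  | const (c) {Ms Ns} : Ms.length = Ns.length → (∀ p ∈ Ms.zip Ns, Par Ar Rr p.1 p.2) →
      Par Ar Rr (.const c Ms) (.const c Ns)
  | type : Par Ar Rr .type .type
  | kind : Par Ar Rr .kind .kind
  | app {M M' N N'} : Par Ar Rr M M' → Par Ar Rr N N' → Par Ar Rr (.app M N) (.app M' N')
  | lam {A A' M M'} : Par Ar Rr A A' → Par Ar Rr M M' → Par Ar Rr (.lam A M) (.lam A' M')
  | pi {A A' B B'} : Par Ar Rr A A' → Par Ar Rr B B' → Par Ar Rr (.pi A B) (.pi A' B')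
  | beta {A P P' Q Q'} : Par Ar Rr P P' → Par Ar Rr Q Q' →
      Par Ar Rr (.app (.lam A P) Q) (Tm.substAt 0 Q' P')
  | el {s₁ s₂} : Ar s₁ s₂ →
      Par Ar Rr (.const (.El s₂) [.const (.u s₁) []]) (.const (.U s₁) [])
  | appAbs {s₁ s₂ s₃ A B A' B' M M' N N'} : Rr s₁ s₂ s₃ → Par Ar Rr M M' → Par Ar Rr N N' →
      Par Ar Rr (.const (.app s₁ s₂) [A, B, .const (.abs s₁ s₂) [A', B', M], N]) (.app M' N')

namespace Par

variable {Ar : S → S → Prop} {Rr : S → S → S → Prop} {M M' : Tm (EConst S)}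

theorem const_forall₂ (c : EConst S) {Ms Ns : List (Tm (EConst S))}
    (h : List.Forall₂ (Par Ar Rr) Ms Ns) : Par Ar Rr (.const c Ms) (.const c Ns) :=
  .const c h.length_eq fun _ hp => (List.forall₂_iff_zip.1 h).2 hp

theorem refl (M : Tm (EConst S)) : Par Ar Rr M M := by
  induction M using Tm.induct with
  | var n => exact .var n
  | const c Ms ih => exact const_forall₂ c (List.forall₂_same.2 ih)
  | type => exact .type
  | kind => exact .kind
  | app M N hM hN => exact .app hM hN
  | lam A M hA hM => exact .lam hA hM
  | pi A B hA hB => exact .pi hA hB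

theorem ren (h : Par Ar Rr M M') (ρ : Nat → Nat) : Par Ar Rr (M.ren ρ) (M'.ren ρ) := by
  induction h generalizing ρ with
  | const c hlen _ ih =>
    rw [Tm.ren_const, Tm.ren_const]
    refine const_forall₂ c (List.forall₂_map_left_iff.2 (List.forall₂_map_right_iff.2 ?_))
    exact List.forall₂_iff_zip.2 ⟨hlen, fun hp => ih _ hp ρ⟩
  | beta _ _ hP hQ =>
    rw [Tm.ren_substAt_zero, Tm.ren_app, Tm.ren_lam]
    exact .beta (hP _) (hQ _)
  | el h => simpa using Par.el h
  | appAbs h _ _ hM hN => simpa using Par.appAbs h (hM ρ) (hN ρ)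
  | var n => exact refl _
  | type => exact refl _
  | kind => exact refl _
  | app _ _ hM hN => simpa using Par.app (hM ρ) (hN ρ)
  | lam _ _ hA hM => simpa using Par.lam (hA ρ) (hM _)
  | pi _ _ hA hB => simpa using Par.pi (hA ρ) (hB _)

theorem liftSub {σ σ' : Nat → Tm (EConst S)} (h : ∀ n, Par Ar Rr (σ n) (σ' n)) :
    ∀ n, Par Ar Rr (Tm.liftSub σ n) (Tm.liftSub σ' n)
  | 0 => .var 0
  | n + 1 => (h n).ren Nat.succ

theorem sub (h : Par Ar Rr M M') {σ σ' : Nat → Tm (EConst S)}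
    (hσ : ∀ n, Par Ar Rr (σ n) (σ' n)) : Par Ar Rr (M.sub σ) (M'.sub σ') := by
  induction h generalizing σ σ' with
  | const c hlen _ ih =>
    rw [Tm.sub_const, Tm.sub_const]
    refine const_forall₂ c (List.forall₂_map_left_iff.2 (List.forall₂_map_right_iff.2 ?_))
    exact List.forall₂_iff_zip.2 ⟨hlen, fun hp => ih _ hp hσ⟩
  | beta _ _ hP hQ =>
    rw [Tm.sub_substAt_zero, Tm.sub_app, Tm.sub_lam]
    exact .beta (hP (liftSub hσ)) (hQ hσ)
  | el h => simpa using Par.el h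
  | appAbs h _ _ hM hN => simpa using Par.appAbs h (hM hσ) (hN hσ)
  | var n => simpa using hσ n
  | type => simpa using Par.type
  | kind => simpa using Par.kind
  | app _ _ hM hN => simpa using Par.app (hM hσ) (hN hσ)
  | lam _ _ hA hM => simpa using Par.lam (hA hσ) (hM (liftSub hσ))
  | pi _ _ hA hB => simpa using Par.pi (hA hσ) (hB (liftSub hσ))

theorem substAt_zero {N N' : Tm (EConst S)} (hM : Par Ar Rr M M') (hN : Par Ar Rr N N') :
    Par Ar Rr (Tm.substAt 0 N M) (Tm.substAt 0 N' M') := by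
  rw [Tm.substAt_zero, Tm.substAt_zero]
  refine hM.sub fun n => ?_
  cases n with
  | zero => exact hN
  | succ n => exact .var n

/-- A parallel reduct of a constant applied to arguments either reduces the arguments only, or
contracts a redex at the root. -/
theorem const_inv {c : EConst S} {Ms : List (Tm (EConst S))} {N : Tm (EConst S)}
    (h : Par Ar Rr (.const c Ms) N) :
    (∃ Ns, N = .const c Ns ∧ List.Forall₂ (Par Ar Rr) Ms Ns) ∨
    (∃ s₁ s₂, Ar s₁ s₂ ∧ c = .El s₂ ∧ Ms = [.const (.u s₁) []] ∧ N = .const (.U s₁) []) ∨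
    (∃ s₁ s₂ s₃ A B A' B' P P' Q Q', Rr s₁ s₂ s₃ ∧ c = .app s₁ s₂ ∧
      Ms = [A, B, .const (.abs s₁ s₂) [A', B', P], Q] ∧ N = .app P' Q' ∧
      Par Ar Rr P P' ∧ Par Ar Rr Q Q') := by
  cases h with
  | const _ hlen hp =>
    exact .inl ⟨_, rfl, List.forall₂_iff_zip.2 ⟨hlen, fun h => hp _ h⟩⟩
  | el h => exact .inr (.inl ⟨_, _, h, rfl, rfl, rfl⟩)
  | appAbs h hM hN =>
    exact .inr (.inr ⟨_, _, _, _, _, _, _, _, _, _, _, h, rfl, rfl, rfl, hM, hN⟩)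

theorem u_inv {s : S} {N : Tm (EConst S)} (h : Par Ar Rr (.const (.u s) []) N) :
    N = .const (.u s) [] := by
  rcases h.const_inv with ⟨Ns, rfl, hNs⟩ | ⟨_, _, _, hc, _⟩ |
    ⟨_, _, _, _, _, _, _, _, _, _, _, _, hc, _⟩
  · rw [List.forall₂_nil_left_iff.1 hNs]
  · cases hc
  · cases hc

theorem abs_inv {s₁ s₂ : S} {A B P N : Tm (EConst S)}
    (h : Par Ar Rr (.const (.abs s₁ s₂) [A, B, P]) N) :
    ∃ A' B' P', N = .const (.abs s₁ s₂) [A', B', P'] ∧ Par Ar Rr P P' := by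
  rcases h.const_inv with ⟨Ns, rfl, hNs⟩ | ⟨_, _, _, hc, _⟩ |
    ⟨_, _, _, _, _, _, _, _, _, _, _, _, hc, _⟩
  · cases hNs with | cons _ hNs => cases hNs with | cons _ hNs => cases hNs with | cons hP hNs =>
    cases hNs
    exact ⟨_, _, _, rfl, hP⟩
  · cases hc
  · cases hc

theorem exists_forall₂_of_forall_exists {α : Type*} {r : α → α → Prop} {Ms : List α}
    (h : ∀ M ∈ Ms, ∃ D, ∀ N, r M N → r N D) :
    ∃ Ds, ∀ Ns, List.Forall₂ r Ms Ns → List.Forall₂ r Ns Ds := by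
  induction Ms with
  | nil => exact ⟨[], fun Ns hNs => by rw [List.forall₂_nil_left_iff.1 hNs]; exact .nil⟩
  | cons M Ms ih =>
    obtain ⟨D, hD⟩ := h M (by simp)
    obtain ⟨Ds, hDs⟩ := ih fun M hM => h M (by simp [hM])
    refine ⟨D :: Ds, fun Ns hNs => ?_⟩
    cases hNs with
    | cons hN hNs => exact .cons (hD _ hN) (hDs _ hNs)

theorem exists_const_development (c : EConst S) {Ms : List (Tm (EConst S))}
    (ih : ∀ M : Tm (EConst S), sizeOf M < sizeOf (Tm.const c Ms) →
      ∃ D, ∀ N, Par Ar Rr M N → Par Ar Rr N D) :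
    ∃ D, ∀ N, Par Ar Rr (.const c Ms) N → Par Ar Rr N D := by
  by_cases hel : ∃ s₁ s₂, Ar s₁ s₂ ∧ c = .El s₂ ∧ Ms = [.const (.u s₁) []]
  · obtain ⟨s₁, s₂, hs, rfl, rfl⟩ := hel
    refine ⟨.const (.U s₁) [], fun N hN => ?_⟩
    rcases hN.const_inv with ⟨Ns, rfl, hNs⟩ | ⟨_, _, _, _, hM, rfl⟩ |
      ⟨_, _, _, _, _, _, _, _, _, _, _, _, hc, _⟩
    · cases hNs with | cons hu hNs =>
      cases hNs
      rw [hu.u_inv]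
      exact .el hs
    · cases hM
      exact refl _
    · cases hc
  by_cases happ : ∃ s₁ s₂ s₃ A B A' B' P Q, Rr s₁ s₂ s₃ ∧ c = .app s₁ s₂ ∧
      Ms = [A, B, .const (.abs s₁ s₂) [A', B', P], Q]
  · obtain ⟨s₁, s₂, s₃, A, B, A', B', P, Q, hs, rfl, rfl⟩ := happ
    obtain ⟨DP, hDP⟩ := ih P (by simp; omega)
    obtain ⟨DQ, hDQ⟩ := ih Q (by simp; omega)
    refine ⟨.app DP DQ, fun N hN => ?_⟩
    rcases hN.const_inv with ⟨Ns, rfl, hNs⟩ | ⟨_, _, _, hc, _⟩ |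
      ⟨_, _, _, _, _, _, _, _, _, _, _, _, hc, hM, rfl, hP, hQ⟩
    · cases hNs with | cons _ hNs => cases hNs with | cons _ hNs =>
      cases hNs with | cons habs hNs => cases hNs with | cons hQ hNs =>
      cases hNs
      obtain ⟨_, _, _, rfl, hP⟩ := habs.abs_inv
      exact .appAbs hs (hDP _ hP) (hDQ _ hQ)
    · cases hc
    · cases hM
      exact .app (hDP _ hP) (hDQ _ hQ)
  · obtain ⟨Ds, hDs⟩ := exists_forall₂_of_forall_exists (r := Par Ar Rr) (Ms := Ms) fun M hM =>
      ih M (by have := List.sizeOf_lt_of_mem hM; simp; omega)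
    refine ⟨.const c Ds, fun N hN => ?_⟩
    rcases hN.const_inv with ⟨Ns, rfl, hNs⟩ | ⟨s₁, s₂, hs, hc, hM, _⟩ |
      ⟨s₁, s₂, s₃, A, B, A', B', P, _, Q, _, hs, hc, hM, _⟩
    · exact const_forall₂ c (hDs _ hNs)
    · exact absurd ⟨s₁, s₂, hs, hc, hM⟩ hel
    · exact absurd ⟨s₁, s₂, s₃, A, B, A', B', P, Q, hs, hc, hM⟩ happ

theorem exists_app_development {M N DM DN : Tm (EConst S)}
    (ih : ∀ P : Tm (EConst S), sizeOf P < sizeOf (Tm.app M N) →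
      ∃ D, ∀ P', Par Ar Rr P P' → Par Ar Rr P' D)
    (hDM : ∀ M', Par Ar Rr M M' → Par Ar Rr M' DM)
    (hDN : ∀ N', Par Ar Rr N N' → Par Ar Rr N' DN) :
    ∃ D, ∀ P, Par Ar Rr (.app M N) P → Par Ar Rr P D := by
  by_cases hlam : ∃ A P, M = .lam A P
  · obtain ⟨A, P, rfl⟩ := hlam
    obtain ⟨DP, hDP⟩ := ih P (by simp; omega)
    refine ⟨Tm.substAt 0 DN DP, fun R hR => ?_⟩
    cases hR with
    | app hM hN =>
      cases hM with
      | lam _ hP => exact .beta (hDP _ hP) (hDN _ hN)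
    | beta hP hN => exact substAt_zero (hDP _ hP) (hDN _ hN)
  · refine ⟨.app DM DN, fun R hR => ?_⟩
    cases hR with
    | app hM hN => exact .app (hDM _ hM) (hDN _ hN)
    | beta hP hN => exact absurd ⟨_, _, rfl⟩ hlam

/-- Every term has a complete development, to which all its parallel reducts reduce. -/
theorem exists_development (M : Tm (EConst S)) :
    ∃ D, ∀ N, Par Ar Rr M N → Par Ar Rr N D := by
  induction h : sizeOf M using Nat.strong_induction_on generalizing M with
  | _ k ih =>
  subst h
  replace ih : ∀ M' : Tm (EConst S), sizeOf M' < sizeOf M →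
    ∃ D, ∀ N, Par Ar Rr M' N → Par Ar Rr N D := fun M' h => ih _ h M' rfl
  cases M with
  | var n => exact ⟨.var n, fun N hN => by cases hN; exact refl _⟩
  | type => exact ⟨.type, fun N hN => by cases hN; exact refl _⟩
  | kind => exact ⟨.kind, fun N hN => by cases hN; exact refl _⟩
  | const c Ms => exact exists_const_development c ih
  | app M N =>
    obtain ⟨DM, hDM⟩ := ih M (by simp; omega)
    obtain ⟨DN, hDN⟩ := ih N (by simp)
    exact exists_app_development ih hDM hDN
  | lam A M =>
    obtain ⟨DA, hDA⟩ := ih A (by simp; omega)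
    obtain ⟨DM, hDM⟩ := ih M (by simp)
    refine ⟨.lam DA DM, fun N hN => ?_⟩
    cases hN with
    | lam hA hM => exact .lam (hDA _ hA) (hDM _ hM)
  | pi A B =>
    obtain ⟨DA, hDA⟩ := ih A (by simp; omega)
    obtain ⟨DB, hDB⟩ := ih B (by simp)
    refine ⟨.pi DA DB, fun N hN => ?_⟩
    cases hN with
    | pi hA hB => exact .pi (hDA _ hA) (hDB _ hB)

theorem of_step (h : Step (rulesEPTS Ar Rr) M M') : Par Ar Rr M M' := by
  induction h with
  | base h =>
    rcases h with ⟨A, P, Q, rfl, rfl⟩ | ⟨rl, hrl | hrl, σ, rfl, rfl⟩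
    · exact .beta (refl _) (refl _)
    · cases hrl with
      | u_red h => simpa [ucon, Ucon] using Par.el h
    · cases hrl with
      | beta h => simpa [absC] using Par.appAbs h (refl _) (refl _)
  | appL _ ih => exact .app ih (refl _)
  | appR _ ih => exact .app (refl _) ih
  | lamA _ ih => exact .lam ih (refl _)
  | lamM _ ih => exact .lam (refl _) ih
  | piA _ ih => exact .pi ih (refl _)
  | piB _ ih => exact .pi (refl _) ih
  | constArg _ ih =>
    refine const_forall₂ _ (List.rel_append ?_ (.cons ih ?_)) <;>
      exact List.forall₂_same.2 fun _ _ => refl _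

end Par

open Relation in
theorem Cong.reflTransGen_const {r : Tm C → Tm C → Prop} (c : C) {Ms Ns : List (Tm C)}
    (h : List.Forall₂ (ReflTransGen (Cong r)) Ms Ns) (l : List (Tm C)) :
    ReflTransGen (Cong r) (.const c (l ++ Ms)) (.const c (l ++ Ns)) := by
  induction h generalizing l with
  | nil => exact .refl
  | @cons M N Ms Ns hM _ ih =>
    refine (hM.lift (fun M => Tm.const c (l ++ M :: Ms)) fun _ _ => .constArg).trans ?_
    simpa using ih (l ++ [N])

open Relation in
theorem Par.reflTransGen_step {Ar : S → S → Prop} {Rr : S → S → S → Prop}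
    {M M' : Tm (EConst S)} (h : Par Ar Rr M M') :
    ReflTransGen (Step (rulesEPTS Ar Rr)) M M' := by
  have app_congr {M M' N N' : Tm (EConst S)} (hM : ReflTransGen (Step (rulesEPTS Ar Rr)) M M')
      (hN : ReflTransGen (Step (rulesEPTS Ar Rr)) N N') :
      ReflTransGen (Step (rulesEPTS Ar Rr)) (.app M N) (.app M' N') :=
    (hM.lift (Tm.app · N) fun _ _ => .appL).trans (hN.lift (Tm.app M') fun _ _ => .appR)
  induction h with
  | var n => exact .refl
  | type => exact .refl
  | kind => exact .refl
  | const c hlen _ ih =>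
    exact Cong.reflTransGen_const c (List.forall₂_iff_zip.2 ⟨hlen, fun hp => ih _ hp⟩) []
  | app _ _ hM hN => exact app_congr hM hN
  | @lam A A' M M' _ _ hA hM =>
    exact (hA.lift (Tm.lam · M) fun _ _ => .lamA).trans (hM.lift (Tm.lam A') fun _ _ => .lamM)
  | @pi A A' B B' _ _ hA hB =>
    exact (hA.lift (Tm.pi · B) fun _ _ => .piA).trans (hB.lift (Tm.pi A') fun _ _ => .piB)
  | @beta A P P' Q Q' _ _ hP hQ =>
    refine (app_congr (hP.lift (Tm.lam A) fun _ _ => .lamM) hQ).tail ?_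
    exact .base (.inl ⟨A, P', Q', rfl, rfl⟩)
  | el h =>
    refine .single (.base (.inr ⟨_, .inl (.u_red h), Tm.var, ?_⟩))
    simp [ucon, Ucon]
  | @appAbs s₁ s₂ s₃ A B A' B' M M' N N' h _ _ hM hN =>
    refine .head (.base (.inr ⟨_, .inr (.beta h),
      fun n => [A, B, A', B', M, N].getD n .type, ?_, rfl⟩)) ?_
    · simp [absC]
    · simpa using app_congr hM hN

/-- Confluence of the rewrite rules of `(Σ_EPTS, 𝓡_EPTS)` together
with β. -/
theorem rulesEPTS_beta_confluent {S : Type} (Ar : S → S → Prop) (Rr : S → S → S → Prop)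
    (hfun : FunctionalSpec Ar Rr) :
    Confluent (Step (rulesEPTS Ar Rr)) := by
  intro a b c hab hac
  have toPar {x y} (h : Relation.ReflTransGen (Step (rulesEPTS Ar Rr)) x y) :
      Relation.ReflTransGen (Par Ar Rr) x y :=
    h.lift id fun _ _ => Par.of_step
  have ofPar {x y} (h : Relation.ReflTransGen (Par Ar Rr) x y) :
      Relation.ReflTransGen (Step (rulesEPTS Ar Rr)) x y := by
    induction h with
    | refl => exact .refl
    | tail _ h ih => exact ih.trans h.reflTransGen_step
  obtain ⟨d, hbd, hcd⟩ := Relation.church_rosser (r := Par Ar Rr) (fun x y z hy hz =>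
    let ⟨d, hd⟩ := Par.exists_development x
    ⟨d, .single (hd y hy), .single (hd z hz)⟩) (toPar hab) (toPar hac)
  exact ⟨d, ofPar hbd, ofPar hcd⟩

end DKPaper
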